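/- Let J be a graph consisting of a cycle of length 2k together with a set S of chords such that J is bipartite and admits an outerplanar drawing (all vertices on the outer face with no two edges crossing). Then |S| ≤ k − 2. -/

import Mathlib

open Set

/-- A graph is bipartite: its vertices can be split in two parts such that every edge
joins the two parts. -/
def IsBipartite {V : Type*} (G : SimpleGraph V) : Prop :=
  ∃ c : V → Bool, ∀ u v : V, G.Adj u v → c u ≠ c v

/-- A graph admits an outerplanar drawing: it has a straight-line drawing with all
vertices placed (injectively) on a circle — hence in convex position, so that every
vertex is incident to the outer face — in which any two distinct edges meet only at
common endpoints (no two edges cross). -/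
def HasOuterplanarDrawing {V : Type*} (G : SimpleGraph V) : Prop :=
  ∃ pos : V → EuclideanSpace ℝ (Fin 2),
    Function.Injective pos ∧ (∀ v : V, ‖pos v‖ = 1) ∧
    ∀ a b x y : V, G.Adj a b → G.Adj x y → s(a, b) ≠ s(x, y) →
      ∀ p : EuclideanSpace ℝ (Fin 2),
        p ∈ segment ℝ (pos a) (pos b) → p ∈ segment ℝ (pos x) (pos y) →
        ∃ w : V, (w = a ∨ w = b) ∧ (w = x ∨ w = y) ∧ p = pos w

/-- The edges of the cycle of length `2k` on the vertex set `ZMod (2k)`. -/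
def cycleEdges (k : ℕ) : Set (Sym2 (ZMod (2 * k))) :=
  {e | ∃ i : ZMod (2 * k), e = s(i, i + 1)}

/-- The pairs `{a,b}` and `{x,y}` separate each other (for four distinct reals). -/
def NSep (a b x y : ℝ) : Prop := (a < x ↔ b < x) ↔ (a < y ↔ b < y)

lemma nsep_symm {a b x y : ℝ} (hax : a ≠ x) (hay : a ≠ y) (hbx : b ≠ x) (hby : b ≠ y)
    (h : NSep a b x y) : NSep x y a b := by
  unfold NSep at *
  have h1 : x < a ↔ ¬ a < x := ⟨fun h => not_lt.2 h.le, fun h => lt_of_le_of_ne (not_lt.1 h) hax.symm⟩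
  have h2 : y < a ↔ ¬ a < y := ⟨fun h => not_lt.2 h.le, fun h => lt_of_le_of_ne (not_lt.1 h) hay.symm⟩
  have h3 : x < b ↔ ¬ b < x := ⟨fun h => not_lt.2 h.le, fun h => lt_of_le_of_ne (not_lt.1 h) hbx.symm⟩
  have h4 : y < b ↔ ¬ b < y := ⟨fun h => not_lt.2 h.le, fun h => lt_of_le_of_ne (not_lt.1 h) hby.symm⟩
  rw [h1, h2, h3, h4]
  tauto

lemma nsep_three {a b x y : ℝ} (hab : a ≠ b) (hxy : x ≠ y)
    (hax : a ≠ x) (hay : a ≠ y) (hbx : b ≠ x) (hby : b ≠ y)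
    (h1 : NSep a b x y) (h2 : NSep a x b y) (h3 : NSep a y x b) : False := by
  unfold NSep at *
  rcases lt_or_gt_of_ne hab with h | h <;> rcases lt_or_gt_of_ne hxy with h' | h' <;>
  rcases lt_or_gt_of_ne hax with hq2 | hq2 <;> rcases lt_or_gt_of_ne hay with hq3 | hq3 <;>
  rcases lt_or_gt_of_ne hbx with g | g <;> rcases lt_or_gt_of_ne hby with g' | g' <;>
  first
  | (exfalso; linarith)
  | (simp only [h, h', hq2, hq3, g, g', not_lt_of_gt h, not_lt_of_gt h', not_lt_of_gt hq2,
      not_lt_of_gt hq3, not_lt_of_gt g, not_lt_of_gt g', iff_true, true_iff, iff_false, not_true,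
      not_false_iff, false_iff] at h1 h2 h3)

/-- Signed area. -/
def Dt (p q r : EuclideanSpace ℝ (Fin 2)) : ℝ :=
  (q 0 - p 0) * (r 1 - p 1) - (q 1 - p 1) * (r 0 - p 0)

lemma Dt_pos {p q r : EuclideanSpace ℝ (Fin 2)} {α β γ : ℝ}
    (hα : -Real.pi < α) (hγ : γ ≤ Real.pi) (h1 : α < β) (h2 : β < γ)
    (p0 : p 0 = Real.cos α) (p1 : p 1 = Real.sin α)
    (q0 : q 0 = Real.cos β) (q1 : q 1 = Real.sin β)
    (r0 : r 0 = Real.cos γ) (r1 : r 1 = Real.sin γ) : 0 < Dt p q r := by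
  have key : Dt p q r = 4 * Real.sin (β/2 - α/2) * Real.sin (γ/2 - β/2) * Real.sin (γ/2 - α/2) := by
    have e : ∀ t : ℝ, Real.cos t = Real.cos (t/2)^2 - Real.sin (t/2)^2 := fun t => by
      rw [← Real.cos_two_mul']; ring_nf
    have e' : ∀ t : ℝ, Real.sin t = 2 * Real.sin (t/2) * Real.cos (t/2) := fun t => by
      rw [← Real.sin_two_mul]; ring_nf
    unfold Dt
    rw [p0, p1, q0, q1, r0, r1, e α, e β, e γ, e' α, e' β, e' γ, Real.sin_sub, Real.sin_sub,
      Real.sin_sub]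
    have i1 := Real.sin_sq_add_cos_sq (α/2)
    have i2 := Real.sin_sq_add_cos_sq (β/2)
    have i3 := Real.sin_sq_add_cos_sq (γ/2)
    generalize Real.sin (α/2) = a at *
    generalize Real.cos (α/2) = a' at *
    generalize Real.sin (β/2) = b at *
    generalize Real.cos (β/2) = b' at *
    generalize Real.sin (γ/2) = c at *
    generalize Real.cos (γ/2) = c' at *
    have : ∀ A B C A' B' C' : ℝ, (B - A) * (C' - A') - (B' - A') * (C - A) =
      (B * C' - B' * C) * 1 - (A * C' - A' * C) * 1 + (A * B' - A' * B) * 1 := by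
      intros; ring
    rw [this]
    nth_rewrite 1 [← i1]
    nth_rewrite 1 [← i2]
    nth_rewrite 1 [← i3]
    ring
  rw [key]
  have s : ∀ t u : ℝ, -Real.pi < t → u ≤ Real.pi → t < u → 0 < Real.sin (u/2 - t/2) := by
    intro t u h h' hq2
    apply Real.sin_pos_of_pos_of_lt_pi <;> linarith
  have := s α β hα (by linarith) h1
  have := s β γ (by linarith) hγ h2
  have := s α γ hα hγ (by linarith)
  positivity

lemma seg_inter {p q r s : EuclideanSpace ℝ (Fin 2)} (h1 : 0 < Dt p q r) (h2 : 0 < Dt p r s)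
    (h3 : 0 < Dt p q s) (h4 : 0 < Dt q r s) :
    ∃ z, z ∈ segment ℝ p r ∧ z ∈ segment ℝ q s := by
  have hs : Dt q r s + Dt p q s = Dt p r s + Dt p q r := by unfold Dt; ring
  have hpos : 0 < Dt q r s + Dt p q s := by linarith
  set N := Dt q r s + Dt p q s with hN
  refine ⟨(Dt q r s / N) • p + (Dt p q s / N) • r,
    ⟨_, _, by positivity, by positivity, by rw [← add_div]; exact div_self hpos.ne', rfl⟩,
    ⟨Dt p r s / N, Dt p q r / N, by positivity, by positivity,
      by rw [← add_div, ← hs]; exact div_self hpos.ne', ?_⟩⟩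
  ext i
  simp only [PiLp.add_apply, PiLp.smul_apply, smul_eq_mul]
  have : Dt p r s * q i + Dt p q r * s i = Dt q r s * p i + Dt p q s * r i := by
    unfold Dt
    fin_cases i <;> simp <;> ring
  field_simp
  exact this

lemma exists_angle {V : Type*} (pos : V → EuclideanSpace ℝ (Fin 2)) (h : ∀ v, ‖pos v‖ = 1) :
    ∃ θ : V → ℝ, ∀ v, -Real.pi < θ v ∧ θ v ≤ Real.pi ∧ pos v 0 = Real.cos (θ v) ∧
      pos v 1 = Real.sin (θ v) := by
  refine ⟨fun v => Complex.arg ⟨pos v 0, pos v 1⟩, fun v => ?_⟩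
  have hn : ‖(⟨pos v 0, pos v 1⟩ : ℂ)‖ = 1 := by
    have := h v
    rw [EuclideanSpace.norm_eq, Fin.sum_univ_two] at this
    rw [Complex.norm_eq_sqrt_sq_add_sq]
    simpa using this
  have h0 : (⟨pos v 0, pos v 1⟩ : ℂ) ≠ 0 := by
    intro h; rw [h] at hn; simp at hn
  refine ⟨Complex.neg_pi_lt_arg _, Complex.arg_le_pi _, ?_, ?_⟩
  · rw [Complex.cos_arg h0, hn]; simp
  · rw [Complex.sin_arg, hn]; simp

/-- Combinatorial content of an outerplanar drawing. -/
lemma outer_comb {V : Type*} (G : SimpleGraph V) (h : HasOuterplanarDrawing G) :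
    ∃ θ : V → ℝ, Function.Injective θ ∧ ∀ a b x y, G.Adj a b → G.Adj x y →
      a ≠ x → a ≠ y → b ≠ x → b ≠ y → NSep (θ a) (θ b) (θ x) (θ y) := by
  obtain ⟨pos, hinj, hn, hc⟩ := h
  obtain ⟨θ, hθ⟩ := exists_angle pos hn
  have θinj : Function.Injective θ := by
    intro u v huv
    apply hinj
    ext i
    fin_cases i
    · simp [(hθ u).2.2.1, (hθ v).2.2.1, huv]
    · simp [(hθ u).2.2.2, (hθ v).2.2.2, huv]
  refine ⟨θ, θinj, ?_⟩
  have D : ∀ u v w, θ u < θ v → θ v < θ w → 0 < Dt (pos u) (pos v) (pos w) := by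
    intro u v w h1 h2
    obtain ⟨a1, a2, a3, a4⟩ := hθ u
    obtain ⟨b1, b2, b3, b4⟩ := hθ v
    obtain ⟨c1, c2, c3, c4⟩ := hθ w
    exact Dt_pos a1 c2 h1 h2 a3 a4 b3 b4 c3 c4
  have core : ∀ a b x y, G.Adj a b → G.Adj x y →
      θ a < θ x → θ x < θ b → θ b < θ y → False := by
    intro a b x y hab hxy h1 h2 h3
    obtain ⟨z, hz, hz'⟩ := seg_inter (D a x b h1 h2) (D a b y (h1.trans h2) h3)
      (D a x y h1 (h2.trans h3)) (D x b y h2 h3)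
    have n1 : a ≠ x := fun h => by rw [h] at h1; exact lt_irrefl _ h1
    have n2 : x ≠ b := fun h => by rw [h] at h2; exact lt_irrefl _ h2
    have n3 : b ≠ y := fun h => by rw [h] at h3; exact lt_irrefl _ h3
    have n4 : a ≠ y := fun h => by rw [h] at h1; exact lt_irrefl _ (h1.trans (h2.trans h3))
    obtain ⟨w, hw, hw', -⟩ := hc a b x y hab hxy (by
      intro h; rw [Sym2.eq_iff] at h; tauto) z hz hz'
    rcases hw with rfl | rfl <;> rcases hw' with rfl | rfl <;> simp_all
  intro a b x y hab hxy hax hay hbx hby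
  have tax := lt_or_gt_of_ne (θinj.ne hax)
  have tay := lt_or_gt_of_ne (θinj.ne hay)
  have tbx := lt_or_gt_of_ne (θinj.ne hbx)
  have tby := lt_or_gt_of_ne (θinj.ne hby)
  have c1 := core a b x y hab hxy
  have c2 := core b a x y hab.symm hxy
  have c3 := core a b y x hab hxy.symm
  have c4 := core b a y x hab.symm hxy.symm
  have c5 := core x y a b hxy hab
  have c6 := core y x a b hxy.symm hab
  have c7 := core x y b a hxy hab.symm
  have c8 := core y x b a hxy.symm hab.symm
  unfold NSep
  rcases tax with h | h <;> rcases tay with h' | h' <;>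
  rcases tbx with g | g <;> rcases tby with g' | g' <;>
  simp only [h, h', g, g', not_lt_of_gt h, not_lt_of_gt h', not_lt_of_gt g, not_lt_of_gt g',
    forall_true_left, iff_true, true_iff, iff_false, not_true, not_false_iff, false_iff] at * <;>
  tauto

lemma paths_nsep {V : Type*} (G : SimpleGraph V) (θ : V → ℝ) (hθ : Function.Injective θ)
    (hc : ∀ a b x y, G.Adj a b → G.Adj x y →
      a ≠ x → a ≠ y → b ≠ x → b ≠ y → NSep (θ a) (θ b) (θ x) (θ y))
    (f : ℕ → V) (hf : ∀ i, G.Adj (f i) (f (i+1))) (a m c n : ℕ)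
    (hd : ∀ i j, i ≤ m → j ≤ n → f (a + i) ≠ f (c + j)) :
    NSep (θ (f a)) (θ (f (a+m))) (θ (f c)) (θ (f (c+n))) := by
  have gen : ∀ (a b : V) (c n : ℕ), (∀ j < n, NSep (θ a) (θ b) (θ (f (c+j))) (θ (f (c+j+1)))) →
      NSep (θ a) (θ b) (θ (f c)) (θ (f (c+n))) := by
    intro a b c n
    induction n with
    | zero => intro _; exact Iff.rfl
    | succ n ih =>
      intro h
      exact Iff.trans (ih fun j hj => h j (by omega)) (h n (by omega))
  apply gen
  intro j hj
  have d : ∀ i ≤ m, ∀ j ≤ n, θ (f (a+i)) ≠ θ (f (c+j)) := fun i hi j hj => hθ.ne (hd i j hi hj)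
  apply nsep_symm (d 0 (by omega) j (by omega)).symm (d m le_rfl j (by omega)).symm
    (d 0 (by omega) (j+1) (by omega)).symm (d m le_rfl (j+1) (by omega)).symm
  apply gen
  intro i hi
  apply hc _ _ _ _ (hf _) (hf _)
  · exact (hd i j (by omega) (by omega)).symm
  · exact (hd (i+1) j (by omega) (by omega)).symm
  · exact (hd i (j+1) (by omega) (by omega)).symm
  · exact (hd (i+1) (j+1) (by omega) (by omega)).symm

lemma count_aux : ∀ (n l : ℕ) (T : Finset (ℕ × ℕ)),
    (∀ e ∈ T, l ≤ e.1 ∧ e.1 + 3 ≤ e.2 ∧ e.2 ≤ l + n ∧ e.2 % 2 ≠ e.1 % 2) →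
    (∀ e ∈ T, ∀ e' ∈ T, e.1 < e'.1 → e'.1 < e.2 → e.2 < e'.2 → False) →
    2 * T.card ≤ n - 1 := by
  intro n
  induction n using Nat.strong_induction_on with
  | _ n ih =>
  intro l T hT hcr
  -- bound on the part without the top chord
  have main : ∀ U ⊆ T, (l, l+n) ∉ U → 2 * U.card ≤ n - 2 := by
    intro U hU htop
    rcases Nat.eq_zero_or_pos n with hn | hn
    · subst hn
      have : U = ∅ := by
        apply Finset.eq_empty_of_forall_notMem
        intro e he
        have := hT e (hU he); omega
      simp [this]
    by_cases hex : ∃ j, (l, j) ∈ U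
    · have hfin : ∃ j, (l, j) ∈ U ∧ ∀ j', (l, j') ∈ U → j' ≤ j := by
        classical
        obtain ⟨j, hj⟩ := hex
        obtain ⟨e, he, hmax⟩ := Finset.exists_max_image (U.filter (fun e => e.1 = l)) (fun e => e.2)
          ⟨(l, j), by simp [hj]⟩
        rw [Finset.mem_filter] at he
        obtain ⟨a, b⟩ := e
        obtain ⟨he, rfl⟩ := he
        exact ⟨b, he, fun j' hj' => hmax (a, j') (by simp [hj'])⟩
      obtain ⟨j, hj, hmax⟩ := hfin
      have hj' := hT _ (hU hj)
      have hjn : j ≠ l + n := by rintro rfl; exact htop hj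
      simp only at hj'
      have hsplit := Finset.card_filter_add_card_filter_not (s := U) (fun e => e.2 ≤ j)
      have b1 := ih (j - l) (by omega) l (U.filter (fun e => e.2 ≤ j)) (by
        intro e he
        rw [Finset.mem_filter] at he
        have := hT e (hU he.1); omega) (by
        intro e he e' he'
        rw [Finset.mem_filter] at he he'
        exact hcr e (hU he.1) e' (hU he'.1))
      have b2 := ih (l + n - j) (by omega) j (U.filter (fun e => ¬ e.2 ≤ j)) (by
        intro e he
        rw [Finset.mem_filter] at he
        have h1 := hT e (hU he.1)
        have h2 := hcr (l, j) (hU hj) e (hU he.1)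
        have h3 : e.1 ≠ l := by
          intro h
          apply he.2
          apply hmax
          rw [← h]; exact he.1
        simp only at h2
        refine ⟨?_, by omega, by omega, by omega⟩
        by_contra h
        exact h2 (by omega) (by omega) (by omega)) (by
        intro e he e' he'
        rw [Finset.mem_filter] at he he'
        exact hcr e (hU he.1) e' (hU he'.1))
      omega
    · have := ih (n - 1) (by omega) (l + 1) U (by
        intro e he
        have h1 := hT e (hU he)
        have h3 : e.1 ≠ l := by
          intro h
          exact hex ⟨e.2, by rw [← h]; exact he⟩
        omega) (fun e he e' he' => hcr e (hU he) e' (hU he'))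
      omega
  by_cases htop : (l, l+n) ∈ T
  · have h1 := main (T.erase (l, l+n)) (Finset.erase_subset _ _) (Finset.notMem_erase _ _)
    have h2 := Finset.card_erase_add_one htop
    have h3 := hT _ htop
    simp only at h3
    omega
  · have := main T (Finset.Subset.refl _) htop
    omega

/-- Let `J` be a graph consisting of a cycle of length `2k` (here on
the vertex set `ZMod (2k)`, with `k ≥ 2` so that the cycle is a genuine cycle)
together with a set `S` of chords (edges joining non-consecutive vertices of the
cycle) such that `J` is bipartite and admits an outerplanar drawing. Then
`|S| ≤ k - 2`. -/
theorem outerplanar_bipartite_chords_bound (k : ℕ) (hk : 2 ≤ k)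
    (S : Set (Sym2 (ZMod (2 * k))))
    (hchord : ∀ c ∈ S, ∀ a b : ZMod (2 * k), c = s(a, b) →
      a ≠ b ∧ b ≠ a + 1 ∧ a ≠ b + 1)
    (J : SimpleGraph (ZMod (2 * k)))
    (hJ : J = SimpleGraph.fromEdgeSet (cycleEdges k ∪ S))
    (hbip : IsBipartite J) (houter : HasOuterplanarDrawing J) :
    (S.ncard : ℤ) ≤ (k : ℤ) - 2 := by
  classical
  have : NeZero (2 * k) := ⟨by omega⟩
  obtain ⟨θ, θinj, hc⟩ := outer_comb J houter
  obtain ⟨c, hcol⟩ := hbip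
  let f : ℕ → ZMod (2 * k) := fun i => (i : ZMod (2 * k))
  have feq : ∀ i j, f i = f j ↔ i % (2 * k) = j % (2 * k) := fun i j =>
    ZMod.natCast_eq_natCast_iff' i j (2 * k)
  have fsucc : ∀ i, f (i + 1) = f i + 1 := fun i => by simp [f]
  have fper : ∀ i, f (i + 2 * k) = f i := fun i => by rw [feq]; simp
  have fne : ∀ i j, i < j → j < i + 2 * k → f i ≠ f j := by
    intro i j hij hji h
    rw [feq] at h
    have h' : (2 * k) ∣ j - i := (Nat.modEq_iff_dvd' hij.le).1 h
    have := Nat.le_of_dvd (by omega) h'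
    omega
  have hf : ∀ i, J.Adj (f i) (f (i + 1)) := by
    intro i
    rw [hJ, SimpleGraph.fromEdgeSet_adj]
    exact ⟨Or.inl ⟨f i, by rw [fsucc]⟩, fne _ _ (by omega) (by omega)⟩
  have hS : ∀ a b, s(a, b) ∈ S → J.Adj a b := by
    intro a b h
    rw [hJ, SimpleGraph.fromEdgeSet_adj]
    exact ⟨Or.inr h, (hchord _ h a b rfl).1⟩
  have hpar : ∀ i, c (f i) = (c (f 0)).xor (decide (i % 2 = 1)) := by
    intro i
    induction i with
    | zero => simp
    | succ i ih =>
      have h := hcol _ _ (hf i)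
      rw [ih] at h
      rcases Nat.mod_two_eq_zero_or_one i with h2 | h2
      · have h3 : (i + 1) % 2 = 1 := by omega
        rw [h3]; rw [h2] at h
        revert h; cases c (f (i+1)) <;> cases c (f 0) <;> simp
      · have h3 : (i + 1) % 2 = 0 := by omega
        rw [h3]; rw [h2] at h
        revert h; cases c (f (i+1)) <;> cases c (f 0) <;> simp
  let T : Finset (ℕ × ℕ) := (Finset.range (2 * k) ×ˢ Finset.range (2 * k)).filter
    (fun e => e.1 < e.2 ∧ s(f e.1, f e.2) ∈ S)
  have memT : ∀ e, e ∈ T ↔ e.1 < e.2 ∧ e.2 < 2 * k ∧ s(f e.1, f e.2) ∈ S := by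
    intro e
    simp only [T, Finset.mem_filter, Finset.mem_product, Finset.mem_range]
    constructor
    · rintro ⟨⟨_, h⟩, h', hq2⟩; exact ⟨h', h, hq2⟩
    · rintro ⟨h', h, hq2⟩; exact ⟨⟨by omega, h⟩, h', hq2⟩
  have hcard : S.ncard ≤ T.card := by
    have hsub : S ⊆ ((T.image (fun e => s(f e.1, f e.2)) : Finset _) : Set (Sym2 (ZMod (2*k)))) := by
      intro e he
      induction e using Sym2.ind with
      | _ a b =>
      have hab := (hchord _ he a b rfl).1
      have ha : f a.val = a := ZMod.natCast_zmod_val a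
      have hb : f b.val = b := ZMod.natCast_zmod_val b
      have hv : a.val ≠ b.val := fun h => hab (ZMod.val_injective _ h)
      rw [Finset.mem_coe, Finset.mem_image]
      rcases lt_or_gt_of_ne hv with h | h
      · exact ⟨(a.val, b.val), (memT _).2 ⟨h, ZMod.val_lt b, by simp only [ha, hb]; exact he⟩,
          by simp only [ha, hb]⟩
      · exact ⟨(b.val, a.val), (memT _).2 ⟨h, ZMod.val_lt a, by
          simp only [ha, hb]; rw [Sym2.eq_swap]; exact he⟩,
          by simp only [ha, hb]; exact Sym2.eq_swap⟩
    calc S.ncard ≤ ((T.image (fun e => s(f e.1, f e.2)) : Finset _) :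
          Set (Sym2 (ZMod (2*k)))).ncard := Set.ncard_le_ncard hsub (Finset.finite_toSet _)
      _ = (T.image (fun e => s(f e.1, f e.2))).card := Set.ncard_coe_finset _
      _ ≤ T.card := Finset.card_image_le
  have propT : ∀ e ∈ T, e.1 + 3 ≤ e.2 ∧ e.2 < 2 * k ∧ e.2 % 2 ≠ e.1 % 2 := by
    intro e he
    obtain ⟨h1, h2, h3⟩ := (memT e).1 he
    have hch := hchord _ h3 _ _ rfl
    have hp : e.2 % 2 ≠ e.1 % 2 := by
      intro h
      apply hcol _ _ (hS _ _ h3)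
      rw [hpar, hpar e.2, h]
    have : e.2 ≠ e.1 + 1 := by
      intro h
      apply hch.2.1
      rw [h, fsucc]
    refine ⟨by omega, h2, hp⟩
  have htop : (0, 2 * k - 1) ∉ T := by
    intro h
    obtain ⟨h1, h2, h3⟩ := (memT _).1 h
    apply (hchord _ h3 _ _ rfl).2.2
    rw [← fsucc, feq]
    simp only
    rw [Nat.sub_add_cancel (by omega)]; simp
  have hcross : ∀ e ∈ T, ∀ e' ∈ T, e.1 < e'.1 → e'.1 < e.2 → e.2 < e'.2 → False := by
    rintro ⟨i, j⟩ he ⟨x, y⟩ he' h1 h2 h3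
    obtain ⟨_, _, a3⟩ := (memT _).1 he
    obtain ⟨_, b2, b3⟩ := (memT _).1 he'
    simp only at *
    have n : ∀ u v, u < v → v < u + 2 * k → θ (f u) ≠ θ (f v) := fun u v h h' =>
      θinj.ne (fne u v h h')
    have nij := n i j (by omega) (by omega)
    have nix := n i x (by omega) (by omega)
    have niy := n i y (by omega) (by omega)
    have nxj := n x j (by omega) (by omega)
    have nxy := n x y (by omega) (by omega)
    have njy := n j y (by omega) (by omega)
    have s1 : NSep (θ (f i)) (θ (f j)) (θ (f x)) (θ (f y)) :=
      hc _ _ _ _ (hS _ _ a3) (hS _ _ b3) (fne _ _ (by omega) (by omega))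
        (fne _ _ (by omega) (by omega)) (fne _ _ (by omega) (by omega)).symm
        (fne _ _ (by omega) (by omega))
    have s2 := paths_nsep J θ θinj hc f hf i (x - i) j (y - j) (fun u v hu hv =>
      fne _ _ (by omega) (by omega))
    have s3 := paths_nsep J θ θinj hc f hf x (j - x) y (i + 2 * k - y) (fun u v hu hv =>
      fne _ _ (by omega) (by omega))
    rw [show i + (x - i) = x by omega, show j + (y - j) = y by omega] at s2
    rw [show x + (j - x) = j by omega, show y + (i + 2 * k - y) = i + 2 * k by omega, fper] at s3
    have s4 := nsep_symm nxy nix.symm njy nij.symm s3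
    refine nsep_three nij nxy nix niy nxj.symm njy s1 s2 ?_
    unfold NSep at s4 ⊢
    tauto
  have hfinal := count_aux (2 * k - 1) 0 (insert (0, 2 * k - 1) T) (by
    intro e he
    rcases Finset.mem_insert.1 he with rfl | he
    · simp only; omega
    · have := propT e he; omega) (by
    intro e he e' he' h1 h2 h3
    rcases Finset.mem_insert.1 he with rfl | he
    · rcases Finset.mem_insert.1 he' with rfl | he'
      · simp only at *; omega
      · have := propT e' he'; simp only at *; omega
    · rcases Finset.mem_insert.1 he' with rfl | he'
      · simp only at *; omega
      · exact hcross e he e' he' h1 h2 h3)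
  rw [Finset.card_insert_of_notMem htop] at hfinal
  omega
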